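/- Assume d·γ ≤ 2·γ*. There exist c > 0 and λ₀ ≥ 1, depending only on ℓ, α, m, d, J, γ, γ*, such that for every λ ∈ ℝ with |λ| ≥ λ₀ and every solution (u, v, w, z) of the resolvent system with data (f₁, f₂, f₄): ‖U‖ ≤ c·λ²·‖F‖. (This is the resolvent estimate ‖(iλ − A)⁻¹‖ = O(λ²) underlying the polynomial decay of the semigroup at rate t^{-1/2}.) -/

import Mathlib

open MeasureTheory ComplexConjugate

/-- A solution `(λ, u, v, w, z)` (with `w = v 0`, `z = v1 0`) of the resolvent system of the
hybrid Euler–Bernoulli beam with tip body, with data `(f₁, f₂, f₄)`. The fields `u1,…,u4`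
(resp. `v1, v2`, `f1d, f1dd`) are the successive derivatives of `u` (resp. `v`, `f1`)
on `[0,ℓ]`. -/
structure ResolventSol (ℓ α m d J γ γs : ℝ) where
  lam : ℝ
  u : ℝ → ℂ
  u1 : ℝ → ℂ
  u2 : ℝ → ℂ
  u3 : ℝ → ℂ
  u4 : ℝ → ℂ
  v : ℝ → ℂ
  v1 : ℝ → ℂ
  v2 : ℝ → ℂ
  f1 : ℝ → ℂ
  f1d : ℝ → ℂ
  f1dd : ℝ → ℂ
  f2 : ℝ → ℂ
  f41 : ℂ
  f42 : ℂ
  hu1 : ∀ x ∈ Set.Icc (0:ℝ) ℓ, HasDerivWithinAt u (u1 x) (Set.Icc 0 ℓ) x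
  hu2 : ∀ x ∈ Set.Icc (0:ℝ) ℓ, HasDerivWithinAt u1 (u2 x) (Set.Icc 0 ℓ) x
  hu3 : ∀ x ∈ Set.Icc (0:ℝ) ℓ, HasDerivWithinAt u2 (u3 x) (Set.Icc 0 ℓ) x
  hu4 : ∀ x ∈ Set.Icc (0:ℝ) ℓ, HasDerivWithinAt u3 (u4 x) (Set.Icc 0 ℓ) x
  hu4c : ContinuousOn u4 (Set.Icc 0 ℓ)
  hv1 : ∀ x ∈ Set.Icc (0:ℝ) ℓ, HasDerivWithinAt v (v1 x) (Set.Icc 0 ℓ) x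
  hv2 : ∀ x ∈ Set.Icc (0:ℝ) ℓ, HasDerivWithinAt v1 (v2 x) (Set.Icc 0 ℓ) x
  hv2c : ContinuousOn v2 (Set.Icc 0 ℓ)
  hf11 : ∀ x ∈ Set.Icc (0:ℝ) ℓ, HasDerivWithinAt f1 (f1d x) (Set.Icc 0 ℓ) x
  hf12 : ∀ x ∈ Set.Icc (0:ℝ) ℓ, HasDerivWithinAt f1d (f1dd x) (Set.Icc 0 ℓ) x
  hf1c : ContinuousOn f1dd (Set.Icc 0 ℓ)
  hf2c : ContinuousOn f2 (Set.Icc 0 ℓ)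
  res1 : ∀ x ∈ Set.Icc (0:ℝ) ℓ, Complex.I * (lam : ℂ) * u x - v x = f1 x
  res2 : ∀ x ∈ Set.Icc (0:ℝ) ℓ, Complex.I * (lam : ℂ) * v x + (α : ℂ) * u4 x = f2 x
  res3 : Complex.I * (lam : ℂ) * ((m : ℂ) * v 0 + (m : ℂ) * (d : ℂ) * v1 0) +
      (γ : ℂ) * v 0 + (α : ℂ) * u3 0 = (m : ℂ) * f41 + (m : ℂ) * (d : ℂ) * f42
  res4 : Complex.I * (lam : ℂ) * ((m : ℂ) * (d : ℂ) * v 0 +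
        ((J : ℂ) + (m : ℂ) * (d : ℂ) ^ 2) * v1 0) +
      (d : ℂ) * (γ : ℂ) * v 0 + (d : ℂ) * (γs : ℂ) * v1 0 - (α : ℂ) * u2 0 =
      (m : ℂ) * (d : ℂ) * f41 + ((J : ℂ) + (m : ℂ) * (d : ℂ) ^ 2) * f42
  bcu : u ℓ = 0
  bcu1 : u1 ℓ = 0
  bcv : v ℓ = 0
  bcv1 : v1 ℓ = 0

variable {ℓ α m d J γ γs : ℝ}

/-- The phase-space norm `‖U‖` of a resolvent solution. -/
noncomputable def normU (R : ResolventSol ℓ α m d J γ γs) : ℝ :=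
  Real.sqrt ((∫ x in (0:ℝ)..ℓ, (‖R.v x‖ ^ 2 + α * ‖R.u2 x‖ ^ 2)) +
    m * ‖R.v 0‖ ^ 2 + 2 * m * d * (R.v 0 * conj (R.v1 0)).re +
    (J + m * d ^ 2) * ‖R.v1 0‖ ^ 2)

/-- The phase-space norm `‖F‖` of the data of a resolvent solution. -/
noncomputable def normF (R : ResolventSol ℓ α m d J γ γs) : ℝ :=
  Real.sqrt ((∫ x in (0:ℝ)..ℓ, (‖R.f2 x‖ ^ 2 + α * ‖R.f1dd x‖ ^ 2)) +
    m * ‖R.f41‖ ^ 2 + 2 * m * d * (R.f41 * conj R.f42).re +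
    (J + m * d ^ 2) * ‖R.f42‖ ^ 2)

lemma aux_cs {L : ℝ} (hL : 0 < L) {g : ℝ → ℝ} (hg : ContinuousOn g (Set.Icc 0 L)) :
    (∫ x in (0:ℝ)..L, g x) ^ 2 ≤ L * ∫ x in (0:ℝ)..L, g x ^ 2 := by
  have hu : Set.uIcc (0:ℝ) L = Set.Icc 0 L := Set.uIcc_of_le hL.le
  have h1 : IntervalIntegrable g volume 0 L :=
    ContinuousOn.intervalIntegrable (by rw [hu]; exact hg)
  have h2 : IntervalIntegrable (fun x => g x ^ 2) volume 0 L :=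
    ContinuousOn.intervalIntegrable (by rw [hu]; exact hg.pow 2)
  set A := ∫ x in (0:ℝ)..L, g x with hA
  have h3 : 0 ≤ ∫ x in (0:ℝ)..L, (L * g x - A) ^ 2 :=
    intervalIntegral.integral_nonneg hL.le (fun x _ => sq_nonneg _)
  have h4 : (∫ x in (0:ℝ)..L, (L * g x - A) ^ 2)
      = L ^ 2 * (∫ x in (0:ℝ)..L, g x ^ 2) - 2 * L * A * A + L * A ^ 2 := by
    have : ∀ x, (L * g x - A) ^ 2 = L ^ 2 * g x ^ 2 - 2 * L * A * g x + A ^ 2 := by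
      intro x; ring
    simp_rw [this]
    rw [intervalIntegral.integral_add ((h2.const_mul _).sub (h1.const_mul _))
      intervalIntegrable_const, intervalIntegral.integral_sub (h2.const_mul _) (h1.const_mul _),
      intervalIntegral.integral_const_mul, intervalIntegral.integral_const_mul,
      intervalIntegral.integral_const, ← hA]
    simp
  rw [h4] at h3
  have h5 : 0 ≤ L * (L * (∫ x in (0:ℝ)..L, g x ^ 2) - A ^ 2) := by linarith
  have := nonneg_of_mul_nonneg_right h5 hL
  linarith

lemma aux_ftc {E : Type*} [NormedAddCommGroup E] [NormedSpace ℝ E] [CompleteSpace E]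
    {L a : ℝ} (ha : a ∈ Set.Icc (0:ℝ) L) {f df : ℝ → E}
    (hf : ∀ x ∈ Set.Icc (0:ℝ) L, HasDerivWithinAt f (df x) (Set.Icc 0 L) x)
    (hc : ContinuousOn df (Set.Icc 0 L)) :
    ∫ x in a..L, df x = f L - f a := by
  have hsub : Set.Icc a L ⊆ Set.Icc 0 L := Set.Icc_subset_Icc_left ha.1
  apply intervalIntegral.integral_eq_sub_of_hasDerivAt_of_le ha.2
  · intro x hx
    exact ((hf x (hsub hx)).continuousWithinAt).mono hsub
  · intro x hx
    exact (hf x (hsub ⟨hx.1.le, hx.2.le⟩)).hasDerivAt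
      (Icc_mem_nhds (lt_of_le_of_lt ha.1 hx.1) hx.2)
  · exact ContinuousOn.intervalIntegrable (by rw [Set.uIcc_of_le ha.2]; exact hc.mono hsub)

lemma aux_poinc {L : ℝ} (hL : 0 < L) {f df : ℝ → ℂ}
    (hf : ∀ x ∈ Set.Icc (0:ℝ) L, HasDerivWithinAt f (df x) (Set.Icc 0 L) x)
    (hc : ContinuousOn df (Set.Icc 0 L)) (h0 : f L = 0) :
    ∀ x ∈ Set.Icc (0:ℝ) L, ‖f x‖ ^ 2 ≤ L * ∫ y in (0:ℝ)..L, ‖df y‖ ^ 2 := by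
  intro x hx
  have h1 := aux_ftc hx hf hc
  have hu : Set.uIcc (0:ℝ) L = Set.Icc 0 L := Set.uIcc_of_le hL.le
  have hi : IntervalIntegrable (fun y => ‖df y‖) volume 0 L :=
    ContinuousOn.intervalIntegrable (by rw [hu]; exact hc.norm)
  have h2 : ‖f x‖ ≤ ∫ y in (0:ℝ)..L, ‖df y‖ := by
    calc ‖f x‖ = ‖∫ y in x..L, df y‖ := by rw [h1, h0]; simp
      _ ≤ ∫ y in x..L, ‖df y‖ := intervalIntegral.norm_integral_le_integral_norm hx.2
      _ ≤ ∫ y in (0:ℝ)..L, ‖df y‖ :=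
        intervalIntegral.integral_mono_interval hx.1 hx.2 le_rfl
          (Filter.Eventually.of_forall fun y => norm_nonneg _) hi
  calc ‖f x‖ ^ 2 ≤ (∫ y in (0:ℝ)..L, ‖df y‖) ^ 2 := by gcongr
    _ ≤ _ := aux_cs hL hc.norm

lemma aux_dre {a b : ℝ → ℂ} {da db : ℂ} {s : Set ℝ} {x : ℝ}
    (ha : HasDerivWithinAt a da s x) (hb : HasDerivWithinAt b db s x) :
    HasDerivWithinAt (fun y => (a y * conj (b y)).re)
      ((da * conj (b x)).re + (a x * conj db).re) s x := by
  have h1 : HasDerivWithinAt (fun y => conj (b y)) (conj db) s x :=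
    (Complex.conjCLE.toContinuousLinearMap.hasFDerivAt).comp_hasDerivWithinAt x hb
  have h2 := ha.mul h1
  have h3 := (Complex.reCLM.hasFDerivAt).comp_hasDerivWithinAt x h2
  exact h3.congr_deriv (by simp)

lemma aux_nsq (a : ℂ) : ‖a‖ ^ 2 = a.re ^ 2 + a.im ^ 2 := by
  rw [Complex.sq_norm, Complex.normSq_apply]; ring

lemma aux_quad (m d J : ℝ) (a b : ℂ) :
    m * ‖a‖ ^ 2 + 2 * m * d * (a * conj b).re + (J + m * d ^ 2) * ‖b‖ ^ 2
      = m * ‖a + d * b‖ ^ 2 + J * ‖b‖ ^ 2 := by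
  simp only [aux_nsq, Complex.mul_re, Complex.conj_re, Complex.conj_im, Complex.add_re,
    Complex.add_im, Complex.mul_im, Complex.ofReal_re, Complex.ofReal_im]
  ring

/-- weighted Young inequality for complex numbers -/
lemma aux_young {t : ℝ} (ht : 0 < t) (a b : ℂ) :
    (a * conj b).re ≤ (t * ‖b‖ ^ 2 + ‖a‖ ^ 2 / t) / 2 := by
  have h : (a * conj b).re ≤ ‖a‖ * ‖b‖ := by
    calc _ ≤ ‖a * conj b‖ := Complex.re_le_norm _
      _ = _ := by rw [norm_mul, RCLike.norm_conj]
  have h2 : ‖a‖ * ‖b‖ ≤ (t * ‖b‖ ^ 2 + ‖a‖ ^ 2 / t) / 2 := by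
    have e : (t * ‖b‖ ^ 2 + ‖a‖ ^ 2 / t) / 2 - ‖a‖ * ‖b‖ = (t * ‖b‖ - ‖a‖) ^ 2 / (2 * t) := by
      field_simp; ring
    have : 0 ≤ (t * ‖b‖ - ‖a‖) ^ 2 / (2 * t) := by positivity
    linarith
  linarith


lemma cu (R : ResolventSol ℓ α m d J γ γs) : ContinuousOn R.u (Set.Icc 0 ℓ) :=
  fun x hx => (R.hu1 x hx).continuousWithinAt
lemma cu1 (R : ResolventSol ℓ α m d J γ γs) : ContinuousOn R.u1 (Set.Icc 0 ℓ) :=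
  fun x hx => (R.hu2 x hx).continuousWithinAt
lemma cu2 (R : ResolventSol ℓ α m d J γ γs) : ContinuousOn R.u2 (Set.Icc 0 ℓ) :=
  fun x hx => (R.hu3 x hx).continuousWithinAt
lemma cu3 (R : ResolventSol ℓ α m d J γ γs) : ContinuousOn R.u3 (Set.Icc 0 ℓ) :=
  fun x hx => (R.hu4 x hx).continuousWithinAt
lemma cv (R : ResolventSol ℓ α m d J γ γs) : ContinuousOn R.v (Set.Icc 0 ℓ) :=
  fun x hx => (R.hv1 x hx).continuousWithinAt
lemma cf1 (R : ResolventSol ℓ α m d J γ γs) : ContinuousOn R.f1 (Set.Icc 0 ℓ) :=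
  fun x hx => (R.hf11 x hx).continuousWithinAt
lemma cf1d (R : ResolventSol ℓ α m d J γ γs) : ContinuousOn R.f1d (Set.Icc 0 ℓ) :=
  fun x hx => (R.hf12 x hx).continuousWithinAt

lemma res1d (hℓ : 0 < ℓ) (R : ResolventSol ℓ α m d J γ γs) :
    ∀ x ∈ Set.Icc (0:ℝ) ℓ, Complex.I * (R.lam : ℂ) * R.u1 x - R.v1 x = R.f1d x := by
  intro x hx
  have h1 : HasDerivWithinAt R.f1 (Complex.I * (R.lam : ℂ) * R.u1 x - R.v1 x)
      (Set.Icc 0 ℓ) x :=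
    (((R.hu1 x hx).const_mul (Complex.I * (R.lam : ℂ))).sub (R.hv1 x hx)).congr
      (fun y hy => (R.res1 y hy).symm) (R.res1 x hx).symm
  exact (uniqueDiffOn_Icc hℓ x hx).eq_deriv _ h1 (R.hf11 x hx)

lemma res1dd (hℓ : 0 < ℓ) (R : ResolventSol ℓ α m d J γ γs) :
    ∀ x ∈ Set.Icc (0:ℝ) ℓ, Complex.I * (R.lam : ℂ) * R.u2 x - R.v2 x = R.f1dd x := by
  intro x hx
  have h1 : HasDerivWithinAt R.f1d (Complex.I * (R.lam : ℂ) * R.u2 x - R.v2 x)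
      (Set.Icc 0 ℓ) x :=
    (((R.hu2 x hx).const_mul (Complex.I * (R.lam : ℂ))).sub (R.hv2 x hx)).congr
      (fun y hy => (res1d hℓ R y hy).symm) (res1d hℓ R x hx).symm
  exact (uniqueDiffOn_Icc hℓ x hx).eq_deriv _ h1 (R.hf12 x hx)

lemma normU_sq (hℓ : 0 < ℓ) (hα : 0 < α) (hm : 0 < m) (hJ : 0 < J)
    (R : ResolventSol ℓ α m d J γ γs) :
    normU R ^ 2 = (∫ x in (0:ℝ)..ℓ, (‖R.v x‖ ^ 2 + α * ‖R.u2 x‖ ^ 2)) +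
      (m * ‖R.v 0 + d * R.v1 0‖ ^ 2 + J * ‖R.v1 0‖ ^ 2) := by
  have h0 : 0 ≤ ∫ x in (0:ℝ)..ℓ, (‖R.v x‖ ^ 2 + α * ‖R.u2 x‖ ^ 2) :=
    intervalIntegral.integral_nonneg hℓ.le (fun x _ => by positivity)
  rw [normU, add_assoc, add_assoc, ← add_assoc (m * _), aux_quad, Real.sq_sqrt (by positivity)]

lemma normF_sq (hℓ : 0 < ℓ) (hα : 0 < α) (hm : 0 < m) (hJ : 0 < J)
    (R : ResolventSol ℓ α m d J γ γs) :
    normF R ^ 2 = (∫ x in (0:ℝ)..ℓ, (‖R.f2 x‖ ^ 2 + α * ‖R.f1dd x‖ ^ 2)) +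
      (m * ‖R.f41 + d * R.f42‖ ^ 2 + J * ‖R.f42‖ ^ 2) := by
  have h0 : 0 ≤ ∫ x in (0:ℝ)..ℓ, (‖R.f2 x‖ ^ 2 + α * ‖R.f1dd x‖ ^ 2) :=
    intervalIntegral.integral_nonneg hℓ.le (fun x _ => by positivity)
  rw [normF, add_assoc, add_assoc, ← add_assoc (m * _), aux_quad, Real.sq_sqrt (by positivity)]

lemma aux_int (hℓ : 0 < ℓ) {g : ℝ → ℝ} (hg : ContinuousOn g (Set.Icc 0 ℓ)) :
    IntervalIntegrable g volume 0 ℓ :=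
  ContinuousOn.intervalIntegrable (by rw [Set.uIcc_of_le hℓ.le]; exact hg)

/-- Dissipation identity combined with Young. -/
lemma energy (hℓ : 0 < ℓ) (hα : 0 < α) (hm : 0 < m) (hJ : 0 < J)
    (R : ResolventSol ℓ α m d J γ γs) {t : ℝ} (ht : 0 < t) :
    γ * ‖R.v 0‖ ^ 2 + d * γ * (R.v 0 * conj (R.v1 0)).re + d * γs * ‖R.v1 0‖ ^ 2
      ≤ (t * normU R ^ 2 + normF R ^ 2 / t) / 2 := by
  have hcf2 := R.hf2c
  have hcf := R.hf1c
  have hcv := cv R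
  have hcu := cu2 R
  have hcg : ContinuousOn (fun x => (R.f2 x * conj (R.v x)).re
      + α * (R.f1dd x * conj (R.u2 x)).re) (Set.Icc 0 ℓ) := by
    refine ContinuousOn.add ?_ (ContinuousOn.mul continuousOn_const ?_)
    · exact Complex.continuous_re.comp_continuousOn
        (hcf2.mul (Complex.continuous_conj.comp_continuousOn hcv))
    · exact Complex.continuous_re.comp_continuousOn
        (hcf.mul (Complex.continuous_conj.comp_continuousOn hcu))
  have hder : ∀ x ∈ Set.Icc (0:ℝ) ℓ, HasDerivWithinAt
      (fun x => α * ((R.u3 x * conj (R.v x)).re - (R.u2 x * conj (R.v1 x)).re))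
      ((R.f2 x * conj (R.v x)).re + α * (R.f1dd x * conj (R.u2 x)).re) (Set.Icc 0 ℓ) x := by
    intro x hx
    have h := ((aux_dre (R.hu4 x hx) (R.hv1 x hx)).sub
      (aux_dre (R.hu3 x hx) (R.hv2 x hx))).const_mul α
    refine h.congr_deriv (Eq.symm ?_)
    rw [← R.res2 x hx, ← res1dd hℓ R x hx]
    simp only [Complex.mul_re, Complex.conj_re, Complex.conj_im, Complex.add_re, Complex.sub_re,
      Complex.sub_im, Complex.I_re, Complex.I_im,
      Complex.add_im, Complex.mul_im, Complex.ofReal_re, Complex.ofReal_im]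
    ring
  have hftc := aux_ftc (Set.left_mem_Icc.2 hℓ.le) hder hcg
  have hy : (∫ x in (0:ℝ)..ℓ, ((R.f2 x * conj (R.v x)).re
      + α * (R.f1dd x * conj (R.u2 x)).re)) ≤
      ∫ x in (0:ℝ)..ℓ, (t / 2 * (‖R.v x‖ ^ 2 + α * ‖R.u2 x‖ ^ 2)
        + 1 / (2 * t) * (‖R.f2 x‖ ^ 2 + α * ‖R.f1dd x‖ ^ 2)) := by
    apply intervalIntegral.integral_mono_on hℓ.le (aux_int hℓ hcg)
    · apply aux_int hℓ
      fun_prop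
    · intro x hx
      have h1 := aux_young ht (R.f2 x) (R.v x)
      have h2 := mul_le_mul_of_nonneg_left (aux_young ht (R.f1dd x) (R.u2 x)) hα.le
      refine (add_le_add h1 h2).trans (le_of_eq ?_)
      field_simp
      ring
  have hi1 : IntervalIntegrable (fun x => (‖R.v x‖ ^ 2 + α * ‖R.u2 x‖ ^ 2)) volume 0 ℓ :=
    aux_int hℓ (by fun_prop)
  have hi2 : IntervalIntegrable (fun x => (‖R.f2 x‖ ^ 2 + α * ‖R.f1dd x‖ ^ 2)) volume 0 ℓ :=
    aux_int hℓ (by fun_prop)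
  rw [intervalIntegral.integral_add (hi1.const_mul _) (hi2.const_mul _),
    intervalIntegral.integral_const_mul, intervalIntegral.integral_const_mul, hftc] at hy
  rw [normU_sq hℓ hα hm hJ R, normF_sq hℓ hα hm hJ R]
  have hq1 := mul_le_mul_of_nonneg_left
    (aux_young ht (R.f41 + d * R.f42) (R.v 0 + d * R.v1 0)) hm.le
  have hq2 := mul_le_mul_of_nonneg_left (aux_young ht (R.f42) (R.v1 0)) hJ.le
  have hid : γ * ‖R.v 0‖ ^ 2 + d * γ * (R.v 0 * conj (R.v1 0)).re + d * γs * ‖R.v1 0‖ ^ 2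
      = -(α * ((R.u3 0 * conj (R.v 0)).re - (R.u2 0 * conj (R.v1 0)).re))
        + (m * ((R.f41 + d * R.f42) * conj (R.v 0 + d * R.v1 0)).re
          + J * (R.f42 * conj (R.v1 0)).re) := by
    have e3r := congrArg Complex.re R.res3
    have e3i := congrArg Complex.im R.res3
    have e4r := congrArg Complex.re R.res4
    have e4i := congrArg Complex.im R.res4
    simp only [pow_two (d:ℂ), aux_nsq, Complex.mul_re, Complex.conj_re, Complex.conj_im, Complex.add_re,
      Complex.sub_re, Complex.sub_im, Complex.I_re, Complex.I_im,
      Complex.add_im, Complex.mul_im, Complex.ofReal_re, Complex.ofReal_im] at e3r e3i e4r e4i ⊢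
    linear_combination (R.v 0).re * e3r + (R.v 0).im * e3i + (R.v1 0).re * e4r
      + (R.v1 0).im * e4i
  rw [hid]
  have hb : α * ((R.u3 ℓ * conj (R.v ℓ)).re - (R.u2 ℓ * conj (R.v1 ℓ)).re) = 0 := by
    rw [R.bcv, R.bcv1]; simp
  rw [hb] at hy
  have : (t * ((∫ x in (0:ℝ)..ℓ, (‖R.v x‖ ^ 2 + α * ‖R.u2 x‖ ^ 2)) +
      (m * ‖R.v 0 + d * R.v1 0‖ ^ 2 + J * ‖R.v1 0‖ ^ 2)) +
      ((∫ x in (0:ℝ)..ℓ, (‖R.f2 x‖ ^ 2 + α * ‖R.f1dd x‖ ^ 2)) +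
      (m * ‖R.f41 + d * R.f42‖ ^ 2 + J * ‖R.f42‖ ^ 2)) / t) / 2
      = (t / 2 * (∫ x in (0:ℝ)..ℓ, (‖R.v x‖ ^ 2 + α * ‖R.u2 x‖ ^ 2)) +
        1 / (2 * t) * (∫ x in (0:ℝ)..ℓ, (‖R.f2 x‖ ^ 2 + α * ‖R.f1dd x‖ ^ 2)))
        + (m * ((t * ‖R.v 0 + d * R.v1 0‖ ^ 2 + ‖R.f41 + d * R.f42‖ ^ 2 / t) / 2)
        + J * ((t * ‖R.v1 0‖ ^ 2 + ‖R.f42‖ ^ 2 / t) / 2)) := by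
    field_simp; ring
  rw [this]
  linarith

/-- Pohozaev type identity. -/
lemma pohozaev (hℓ : 0 < ℓ) (R : ResolventSol ℓ α m d J γ γs) :
    (∫ x in (0:ℝ)..ℓ, (3 * α * ‖R.u2 x‖ ^ 2 + R.lam ^ 2 * ‖R.u x‖ ^ 2
      - 2 * (x - ℓ) * ((R.f2 x + Complex.I * R.lam * R.f1 x) * conj (R.u1 x)).re)) =
    -ℓ * (2 * α * (R.u3 0 * conj (R.u1 0)).re - α * ‖R.u2 0‖ ^ 2 - R.lam ^ 2 * ‖R.u 0‖ ^ 2)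
      - 2 * α * (R.u2 0 * conj (R.u1 0)).re := by
  have hcf2 := R.hf2c
  have hcf := cf1 R
  have hcu := cu R
  have hcu1 := cu1 R
  have hcu2 := cu2 R
  have hN : ∀ a : ℂ, ‖a‖ ^ 2 = (a * conj a).re := by
    intro a; rw [aux_nsq]; simp; ring
  have hcg : ContinuousOn (fun x => (3 * α * ‖R.u2 x‖ ^ 2 + R.lam ^ 2 * ‖R.u x‖ ^ 2
      - 2 * (x - ℓ) * ((R.f2 x + Complex.I * R.lam * R.f1 x) * conj (R.u1 x)).re))
      (Set.Icc 0 ℓ) := by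
    refine ContinuousOn.sub (by fun_prop) (ContinuousOn.mul (by fun_prop) ?_)
    exact Complex.continuous_re.comp_continuousOn
        (ContinuousOn.mul (by fun_prop) (Complex.continuous_conj.comp_continuousOn hcu1))
  have hder : ∀ x ∈ Set.Icc (0:ℝ) ℓ, HasDerivWithinAt
      (fun x => 2 * α * (R.u2 x * conj (R.u1 x)).re - (x - ℓ) *
        (2 * α * (R.u3 x * conj (R.u1 x)).re - α * (R.u2 x * conj (R.u2 x)).re
          - R.lam ^ 2 * (R.u x * conj (R.u x)).re))
      (3 * α * ‖R.u2 x‖ ^ 2 + R.lam ^ 2 * ‖R.u x‖ ^ 2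
      - 2 * (x - ℓ) * ((R.f2 x + Complex.I * R.lam * R.f1 x) * conj (R.u1 x)).re)
      (Set.Icc 0 ℓ) x := by
    intro x hx
    have h := ((aux_dre (R.hu3 x hx) (R.hu2 x hx)).const_mul (2 * α)).sub
      (((hasDerivWithinAt_id x (Set.Icc 0 ℓ)).sub_const ℓ).mul
        ((((aux_dre (R.hu4 x hx) (R.hu2 x hx)).const_mul (2 * α)).sub
          ((aux_dre (R.hu3 x hx) (R.hu3 x hx)).const_mul α)).sub
          ((aux_dre (R.hu1 x hx) (R.hu1 x hx)).const_mul (R.lam ^ 2))))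
    refine h.congr_deriv (Eq.symm ?_)
    rw [← R.res2 x hx, ← R.res1 x hx]
    simp only [aux_nsq, Complex.mul_re, Complex.conj_re, Complex.conj_im, Complex.add_re,
      Complex.sub_re, Complex.sub_im, Complex.I_re, Complex.I_im, id, Pi.sub_apply,
      Complex.add_im, Complex.mul_im, Complex.ofReal_re, Complex.ofReal_im]
    ring
  rw [aux_ftc (Set.left_mem_Icc.2 hℓ.le) hder hcg, R.bcu1, hN, hN]
  simp
  ring


lemma integ_add (hℓ : 0 < ℓ) {f g : ℝ → ℂ} (hf : ContinuousOn f (Set.Icc 0 ℓ))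
    (hg : ContinuousOn g (Set.Icc 0 ℓ)) (a b : ℝ) :
    ∫ x in (0:ℝ)..ℓ, (a * ‖f x‖ ^ 2 + b * ‖g x‖ ^ 2) =
      a * (∫ x in (0:ℝ)..ℓ, ‖f x‖ ^ 2) + b * ∫ x in (0:ℝ)..ℓ, ‖g x‖ ^ 2 := by
  have h1 : IntervalIntegrable (fun x => ‖f x‖ ^ 2) volume 0 ℓ := aux_int hℓ (by fun_prop)
  have h2 : IntervalIntegrable (fun x => ‖g x‖ ^ 2) volume 0 ℓ := aux_int hℓ (by fun_prop)
  rw [intervalIntegral.integral_add (h1.const_mul _) (h2.const_mul _),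
    intervalIntegral.integral_const_mul, intervalIntegral.integral_const_mul]

lemma integ_nn (hℓ : 0 < ℓ) (f : ℝ → ℂ) : 0 ≤ ∫ x in (0:ℝ)..ℓ, ‖f x‖ ^ 2 :=
  intervalIntegral.integral_nonneg hℓ.le (fun x _ => by positivity)

lemma normF_parts (hℓ : 0 < ℓ) (hα : 0 < α) (hm : 0 < m) (hJ : 0 < J)
    (R : ResolventSol ℓ α m d J γ γs) :
    (∫ x in (0:ℝ)..ℓ, ‖R.f2 x‖ ^ 2) ≤ normF R ^ 2 ∧
    α * (∫ x in (0:ℝ)..ℓ, ‖R.f1dd x‖ ^ 2) ≤ normF R ^ 2 ∧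
    m * ‖R.f41 + d * R.f42‖ ^ 2 ≤ normF R ^ 2 ∧ J * ‖R.f42‖ ^ 2 ≤ normF R ^ 2 := by
  have h := integ_add hℓ R.hf2c R.hf1c 1 α
  simp only [one_mul] at h
  rw [normF_sq hℓ hα hm hJ R, h]
  have h1 := integ_nn hℓ R.f2
  have h2 := mul_nonneg hα.le (integ_nn hℓ R.f1dd)
  have h3 : 0 ≤ m * ‖R.f41 + d * R.f42‖ ^ 2 := by positivity
  have h4 : 0 ≤ J * ‖R.f42‖ ^ 2 := by positivity
  refine ⟨?_, ?_, ?_, ?_⟩ <;> linarith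

lemma f1d_bound (hℓ : 0 < ℓ) (hα : 0 < α) (hm : 0 < m) (hJ : 0 < J)
    (R : ResolventSol ℓ α m d J γ γs) :
    ∀ x ∈ Set.Icc (0:ℝ) ℓ, ‖R.f1d x‖ ^ 2 ≤ ℓ / α * normF R ^ 2 := by
  intro x hx
  have h0 : R.f1d ℓ = 0 := by
    rw [← res1d hℓ R ℓ (Set.right_mem_Icc.2 hℓ.le), R.bcu1, R.bcv1]; simp
  refine (aux_poinc hℓ R.hf12 R.hf1c h0 x hx).trans ?_
  have h := (normF_parts hℓ hα hm hJ R).2.1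
  rw [div_mul_eq_mul_div, le_div_iff₀ hα]
  have := mul_le_mul_of_nonneg_left h hℓ.le
  linarith

lemma f1_bound (hℓ : 0 < ℓ) (hα : 0 < α) (hm : 0 < m) (hJ : 0 < J)
    (R : ResolventSol ℓ α m d J γ γs) :
    ∀ x ∈ Set.Icc (0:ℝ) ℓ, ‖R.f1 x‖ ^ 2 ≤ ℓ ^ 3 / α * normF R ^ 2 := by
  intro x hx
  have h0 : R.f1 ℓ = 0 := by
    rw [← R.res1 ℓ (Set.right_mem_Icc.2 hℓ.le), R.bcu, R.bcv]; simp
  refine (aux_poinc hℓ R.hf11 (cf1d R) h0 x hx).trans ?_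
  have hc := cf1d R
  have h : (∫ y in (0:ℝ)..ℓ, ‖R.f1d y‖ ^ 2) ≤ ∫ y in (0:ℝ)..ℓ, ℓ / α * normF R ^ 2 :=
    intervalIntegral.integral_mono_on hℓ.le (aux_int hℓ (by fun_prop))
      intervalIntegrable_const (f1d_bound hℓ hα hm hJ R)
  rw [intervalIntegral.integral_const] at h
  simp only [sub_zero, smul_eq_mul] at h
  calc _ ≤ ℓ * (ℓ * (ℓ / α * normF R ^ 2)) := by gcongr
    _ = _ := by ring

/-- Lower bound of the interior part. -/
lemma interior_bd (hℓ : 0 < ℓ) (hα : 0 < α) (hm : 0 < m) (hJ : 0 < J)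
    (R : ResolventSol ℓ α m d J γ γs) (hl : 1 ≤ |R.lam|) :
    2 * α * (∫ x in (0:ℝ)..ℓ, ‖R.u2 x‖ ^ 2) + R.lam ^ 2 * (∫ x in (0:ℝ)..ℓ, ‖R.u x‖ ^ 2)
      - (2 * ℓ ^ 4 / α + 2 * ℓ ^ 8 / α ^ 2) * R.lam ^ 2 * normF R ^ 2 ≤
    -ℓ * (2 * α * (R.u3 0 * conj (R.u1 0)).re - α * ‖R.u2 0‖ ^ 2 - R.lam ^ 2 * ‖R.u 0‖ ^ 2)
      - 2 * α * (R.u2 0 * conj (R.u1 0)).re := by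
  rw [← pohozaev hℓ R]
  have hcf2 := R.hf2c
  have hcf := cf1 R
  have hcu := cu R
  have hcu1 := cu1 R
  have hcu2 := cu2 R
  set I2 := ∫ x in (0:ℝ)..ℓ, ‖R.u2 x‖ ^ 2 with hI2
  set P := normF R
  have hi2 : IntervalIntegrable (fun x => ‖R.f2 x‖ ^ 2) volume 0 ℓ := aux_int hℓ (by fun_prop)
  have hi3 : IntervalIntegrable (fun x => 3 * α * ‖R.u2 x‖ ^ 2 + R.lam ^ 2 * ‖R.u x‖ ^ 2)
    volume 0 ℓ := aux_int hℓ (by fun_prop)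
  have hl2 : 1 ≤ R.lam ^ 2 := by rw [← sq_abs]; nlinarith
  have key : (∫ x in (0:ℝ)..ℓ, ((3 * α * ‖R.u2 x‖ ^ 2 + R.lam ^ 2 * ‖R.u x‖ ^ 2)
      - (2 * ℓ ^ 4 / α) * ‖R.f2 x‖ ^ 2
      - (α / ℓ * I2 + (2 * ℓ ^ 4 / α) * R.lam ^ 2 * (ℓ ^ 3 / α * P ^ 2)))) ≤
      ∫ x in (0:ℝ)..ℓ, (3 * α * ‖R.u2 x‖ ^ 2 + R.lam ^ 2 * ‖R.u x‖ ^ 2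
      - 2 * (x - ℓ) * ((R.f2 x + Complex.I * R.lam * R.f1 x) * conj (R.u1 x)).re) := by
    apply intervalIntegral.integral_mono_on hℓ.le
    · exact aux_int hℓ (by fun_prop)
    · apply aux_int hℓ
      refine ContinuousOn.sub (by fun_prop) (ContinuousOn.mul (by fun_prop) ?_)
      exact Complex.continuous_re.comp_continuousOn
        (ContinuousOn.mul (by fun_prop) (Complex.continuous_conj.comp_continuousOn hcu1))
    · intro x hx
      have a1 := aux_poinc hℓ R.hu2 (cu2 R) R.bcu1 x hx
      rw [← hI2] at a1
      have a2 := f1_bound hℓ hα hm hJ R x hx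
      set g := R.f2 x + Complex.I * R.lam * R.f1 x with hg
      have a3 : ‖g‖ ^ 2 ≤ 2 * ‖R.f2 x‖ ^ 2 + 2 * R.lam ^ 2 * ‖R.f1 x‖ ^ 2 := by
        have h1 : ‖g‖ ≤ ‖R.f2 x‖ + |R.lam| * ‖R.f1 x‖ := by
          refine (norm_add_le _ _).trans (le_of_eq ?_)
          simp
        calc ‖g‖ ^ 2 ≤ (‖R.f2 x‖ + |R.lam| * ‖R.f1 x‖) ^ 2 := by gcongr
          _ ≤ 2 * ‖R.f2 x‖ ^ 2 + 2 * (|R.lam| * ‖R.f1 x‖) ^ 2 := by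
            nlinarith [sq_nonneg (‖R.f2 x‖ - |R.lam| * ‖R.f1 x‖)]
          _ = _ := by rw [mul_pow, sq_abs]; ring
      have hδ : 0 < 2 * α / ℓ ^ 2 := by positivity
      have a4 := aux_young hδ (((2 * (x - ℓ) : ℝ) : ℂ) * g) (R.u1 x)
      have a5 : ((((2 * (x - ℓ) : ℝ) : ℂ) * g) * conj (R.u1 x)).re
          = 2 * (x - ℓ) * (g * conj (R.u1 x)).re := by
        rw [mul_assoc, Complex.re_ofReal_mul]
      have a6 : ‖((2 * (x - ℓ) : ℝ) : ℂ) * g‖ ^ 2 ≤ 4 * ℓ ^ 2 * ‖g‖ ^ 2 := by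
        rw [norm_mul, mul_pow, Complex.norm_real, Real.norm_eq_abs, sq_abs]
        have : (2 * (x - ℓ)) ^ 2 ≤ 4 * ℓ ^ 2 := by nlinarith [hx.1, hx.2]
        gcongr
      rw [a5] at a4
      have a7 : 2 * (x - ℓ) * (g * conj (R.u1 x)).re ≤
          (2 * α / ℓ ^ 2 * (ℓ * I2) + (4 * ℓ ^ 2 * (2 * ‖R.f2 x‖ ^ 2 + 2 * R.lam ^ 2 *
            (ℓ ^ 3 / α * P ^ 2))) / (2 * α / ℓ ^ 2)) / 2 := by
        refine a4.trans ?_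
        gcongr
        refine a6.trans ?_
        gcongr
        refine a3.trans ?_
        gcongr
      have a8 : (2 * α / ℓ ^ 2 * (ℓ * I2) + (4 * ℓ ^ 2 * (2 * ‖R.f2 x‖ ^ 2 + 2 * R.lam ^ 2 *
            (ℓ ^ 3 / α * P ^ 2))) / (2 * α / ℓ ^ 2)) / 2 = (2 * ℓ ^ 4 / α) * ‖R.f2 x‖ ^ 2 +
          (α / ℓ * I2 + (2 * ℓ ^ 4 / α) * R.lam ^ 2 * (ℓ ^ 3 / α * P ^ 2)) := by
        field_simp
        ring
      rw [a8] at a7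
      linarith
  rw [intervalIntegral.integral_sub (hi3.sub (hi2.const_mul _)) intervalIntegrable_const,
    intervalIntegral.integral_sub hi3 (hi2.const_mul _), integ_add hℓ hcu2 hcu,
    intervalIntegral.integral_const_mul, intervalIntegral.integral_const, ← hI2] at key
  simp only [sub_zero, smul_eq_mul] at key
  refine le_trans ?_ key
  have b1 := (normF_parts hℓ hα hm hJ R).1
  have b2 : (2 * ℓ ^ 4 / α) * (∫ x in (0:ℝ)..ℓ, ‖R.f2 x‖ ^ 2) ≤
      (2 * ℓ ^ 4 / α) * (R.lam ^ 2 * P ^ 2) := by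
    gcongr
    nlinarith [sq_nonneg P]
  have b3 : ℓ * (α / ℓ * I2 + (2 * ℓ ^ 4 / α) * R.lam ^ 2 * (ℓ ^ 3 / α * P ^ 2))
      = α * I2 + 2 * ℓ ^ 8 / α ^ 2 * R.lam ^ 2 * P ^ 2 := by
    field_simp
  rw [b3]
  linarith

/-- Upper bound of the boundary part. -/
lemma boundary_bd (hℓ : 0 < ℓ) (hα : 0 < α) (hm : 0 < m) (hd : 0 < d) (hJ : 0 < J)
    (hγ : 0 < γ) (hγs : 0 < γs) :
    ∃ K > 0, ∀ R : ResolventSol ℓ α m d J γ γs, 1 ≤ |R.lam| →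
      -ℓ * (2 * α * (R.u3 0 * conj (R.u1 0)).re - α * ‖R.u2 0‖ ^ 2 - R.lam ^ 2 * ‖R.u 0‖ ^ 2)
        - 2 * α * (R.u2 0 * conj (R.u1 0)).re ≤
      K * (R.lam ^ 2 * (‖R.v 0‖ ^ 2 + ‖R.v1 0‖ ^ 2) + normF R ^ 2) := by
  obtain ⟨K0, hK0⟩ : ∃ K, K = 1 + √(ℓ ^ 3 / α) := ⟨_, rfl⟩
  obtain ⟨K1, hK1⟩ : ∃ K, K = 1 + √(ℓ / α) := ⟨_, rfl⟩
  obtain ⟨K2, hK2⟩ : ∃ K, K = (m * d + (J + m * d ^ 2) + d * γ + d * γs +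
    (m * d * √(1 / m) + J * √(1 / J))) / α := ⟨_, rfl⟩
  obtain ⟨K3, hK3⟩ : ∃ K, K = (m + m * d + γ + m * √(1 / m)) / α := ⟨_, rfl⟩
  have p0 : 0 < K0 := by rw [hK0]; positivity
  have p1 : 0 < K1 := by rw [hK1]; positivity
  have p2 : 0 < K2 := by rw [hK2]; positivity
  have p3 : 0 < K3 := by rw [hK3]; positivity
  refine ⟨ℓ * (2 * α * (K3 * K1) + α * K2 ^ 2 + K0 ^ 2) + 2 * α * (K2 * K1), by positivity, ?_⟩
  intro R hl
  obtain ⟨S, hS⟩ : ∃ S, S = √(R.lam ^ 2 * (‖R.v 0‖ ^ 2 + ‖R.v1 0‖ ^ 2) + normF R ^ 2) := ⟨_, rfl⟩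
  have hS2 : S ^ 2 = R.lam ^ 2 * (‖R.v 0‖ ^ 2 + ‖R.v1 0‖ ^ 2) + normF R ^ 2 := by
    rw [hS]; exact Real.sq_sqrt (by positivity)
  have hS0 : 0 ≤ S := by rw [hS]; positivity
  have hw : |R.lam| * ‖R.v 0‖ ≤ S := by
    rw [hS]; apply Real.le_sqrt_of_sq_le; rw [mul_pow, sq_abs]
    have : 0 ≤ R.lam ^ 2 * ‖R.v1 0‖ ^ 2 := by positivity
    nlinarith [sq_nonneg (normF R)]
  have hz : |R.lam| * ‖R.v1 0‖ ≤ S := by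
    rw [hS]; apply Real.le_sqrt_of_sq_le; rw [mul_pow, sq_abs]
    have : 0 ≤ R.lam ^ 2 * ‖R.v 0‖ ^ 2 := by positivity
    nlinarith [sq_nonneg (normF R)]
  have hw1 : ‖R.v 0‖ ≤ S := le_trans (by nlinarith [norm_nonneg (R.v 0)]) hw
  have hz1 : ‖R.v1 0‖ ≤ S := le_trans (by nlinarith [norm_nonneg (R.v1 0)]) hz
  have hP : normF R ^ 2 ≤ S ^ 2 := by
    rw [hS2]; have : 0 ≤ R.lam ^ 2 * (‖R.v 0‖ ^ 2 + ‖R.v1 0‖ ^ 2) := by positivity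
    linarith
  have hroot : ∀ (c : ℝ) (x : ℂ), 0 ≤ c → ‖x‖ ^ 2 ≤ c * S ^ 2 → ‖x‖ ≤ √c * S := by
    intro c x hc h
    refine abs_le_of_sq_le_sq' ?_ (by positivity) |>.2
    rw [mul_pow, Real.sq_sqrt hc]; exact h
  have h0 : (0:ℝ) ∈ Set.Icc (0:ℝ) ℓ := Set.left_mem_Icc.2 hℓ.le
  have hf1 : ‖R.f1 0‖ ≤ √(ℓ ^ 3 / α) * S := hroot _ _ (by positivity)
    ((f1_bound hℓ hα hm hJ R 0 h0).trans (by gcongr))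
  have hf1d : ‖R.f1d 0‖ ≤ √(ℓ / α) * S := hroot _ _ (by positivity)
    ((f1d_bound hℓ hα hm hJ R 0 h0).trans (by gcongr))
  obtain ⟨-, -, q1, q2⟩ := normF_parts hℓ hα hm hJ R
  have hg1 : ‖R.f41 + d * R.f42‖ ≤ √(1 / m) * S := hroot _ _ (by positivity) (by
    rw [div_mul_eq_mul_div, le_div_iff₀ hm]; linarith)
  have hg2 : ‖R.f42‖ ≤ √(1 / J) * S := hroot _ _ (by positivity) (by
    rw [div_mul_eq_mul_div, le_div_iff₀ hJ]; linarith)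
  have b0 : |R.lam| * ‖R.u 0‖ ≤ K0 * S := by
    have e : Complex.I * R.lam * R.u 0 = R.v 0 + R.f1 0 := by
      linear_combination R.res1 0 h0
    have := congrArg norm e
    simp only [norm_mul, Complex.norm_I, one_mul, Complex.norm_real, Real.norm_eq_abs] at this
    rw [this, hK0]
    linarith [norm_add_le (R.v 0) (R.f1 0)]
  have b1 : ‖R.u1 0‖ ≤ K1 * S := by
    have e : Complex.I * R.lam * R.u1 0 = R.v1 0 + R.f1d 0 := by
      linear_combination res1d hℓ R 0 h0
    have := congrArg norm e
    simp only [norm_mul, Complex.norm_I, one_mul, Complex.norm_real, Real.norm_eq_abs] at this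
    have h3 : ‖R.u1 0‖ ≤ |R.lam| * ‖R.u1 0‖ := by nlinarith [norm_nonneg (R.u1 0)]
    refine h3.trans ?_
    rw [this, hK1]
    linarith [norm_add_le (R.v1 0) (R.f1d 0)]
  have nI : ∀ x : ℂ, ‖Complex.I * R.lam * x‖ = |R.lam| * ‖x‖ := by
    intro x; simp
  have nr : ∀ (r : ℝ) (x : ℂ), 0 < r → ‖(r : ℂ) * x‖ = r * ‖x‖ := by
    intro r x hr; rw [norm_mul, Complex.norm_real, Real.norm_eq_abs, abs_of_pos hr]
  have b3 : ‖R.u3 0‖ ≤ K3 * S := by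
    have e : (α : ℂ) * R.u3 0 = (m : ℂ) * (R.f41 + d * R.f42)
        - (m : ℂ) * (Complex.I * R.lam * R.v 0)
        - ((m * d : ℝ) : ℂ) * (Complex.I * R.lam * R.v1 0) - (γ : ℂ) * R.v 0 := by
      push_cast
      linear_combination R.res3
    have h1 := congrArg norm e
    rw [nr _ _ hα] at h1
    have h2 := norm_sub_le ((m : ℂ) * (R.f41 + d * R.f42)
        - (m : ℂ) * (Complex.I * R.lam * R.v 0)
        - ((m * d : ℝ) : ℂ) * (Complex.I * R.lam * R.v1 0)) ((γ : ℂ) * R.v 0)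
    have h3 := norm_sub_le ((m : ℂ) * (R.f41 + d * R.f42)
        - (m : ℂ) * (Complex.I * R.lam * R.v 0))
        (((m * d : ℝ) : ℂ) * (Complex.I * R.lam * R.v1 0))
    have h4 := norm_sub_le ((m : ℂ) * (R.f41 + d * R.f42))
        ((m : ℂ) * (Complex.I * R.lam * R.v 0))
    rw [nr _ _ hγ] at h2
    rw [nr _ _ (mul_pos hm hd), nI] at h3
    rw [nr _ _ hm, nr _ _ hm, nI] at h4
    rw [hK3, div_mul_eq_mul_div, le_div_iff₀ hα]
    have k1 := mul_le_mul_of_nonneg_left hg1 hm.le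
    have k2 := mul_le_mul_of_nonneg_left hw hm.le
    have k3 := mul_le_mul_of_nonneg_left hz (mul_pos hm hd).le
    have k4 := mul_le_mul_of_nonneg_left hw1 hγ.le
    linarith
  have b2 : ‖R.u2 0‖ ≤ K2 * S := by
    have hJm : 0 < J + m * d ^ 2 := by positivity
    have e : (α : ℂ) * R.u2 0 = ((m * d : ℝ) : ℂ) * (Complex.I * R.lam * R.v 0)
        + ((J + m * d ^ 2 : ℝ) : ℂ) * (Complex.I * R.lam * R.v1 0)
        + ((d * γ : ℝ) : ℂ) * R.v 0 + ((d * γs : ℝ) : ℂ) * R.v1 0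
        - ((m * d : ℝ) : ℂ) * (R.f41 + d * R.f42) - (J : ℂ) * R.f42 := by
      push_cast
      linear_combination -R.res4
    have h1 := congrArg norm e
    rw [nr _ _ hα] at h1
    have h2 := norm_sub_le (((m * d : ℝ) : ℂ) * (Complex.I * R.lam * R.v 0)
        + ((J + m * d ^ 2 : ℝ) : ℂ) * (Complex.I * R.lam * R.v1 0)
        + ((d * γ : ℝ) : ℂ) * R.v 0 + ((d * γs : ℝ) : ℂ) * R.v1 0
        - ((m * d : ℝ) : ℂ) * (R.f41 + d * R.f42)) ((J : ℂ) * R.f42)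
    have h3 := norm_sub_le (((m * d : ℝ) : ℂ) * (Complex.I * R.lam * R.v 0)
        + ((J + m * d ^ 2 : ℝ) : ℂ) * (Complex.I * R.lam * R.v1 0)
        + ((d * γ : ℝ) : ℂ) * R.v 0 + ((d * γs : ℝ) : ℂ) * R.v1 0)
        (((m * d : ℝ) : ℂ) * (R.f41 + d * R.f42))
    have h4 := norm_add₄_le (a := ((m * d : ℝ) : ℂ) * (Complex.I * R.lam * R.v 0))
        (b := ((J + m * d ^ 2 : ℝ) : ℂ) * (Complex.I * R.lam * R.v1 0))
        (c := ((d * γ : ℝ) : ℂ) * R.v 0) (d := ((d * γs : ℝ) : ℂ) * R.v1 0)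
    rw [nr _ _ hJ] at h2
    rw [nr _ (R.f41 + d * R.f42) (mul_pos hm hd)] at h3
    rw [nr _ _ (mul_pos hm hd), nr _ _ hJm, nr _ _ (mul_pos hd hγ), nr _ _ (mul_pos hd hγs),
      nI, nI] at h4
    rw [hK2, div_mul_eq_mul_div, le_div_iff₀ hα]
    have k1 := mul_le_mul_of_nonneg_left hg1 (mul_pos hm hd).le
    have k2 := mul_le_mul_of_nonneg_left hw (mul_pos hm hd).le
    have k3 := mul_le_mul_of_nonneg_left hz hJm.le
    have k4 := mul_le_mul_of_nonneg_left hw1 (mul_pos hd hγ).le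
    have k5 := mul_le_mul_of_nonneg_left hz1 (mul_pos hd hγs).le
    have k6 := mul_le_mul_of_nonneg_left hg2 hJ.le
    linarith
  rw [← hS2]
  have hre : ∀ a b : ℂ, |(a * conj b).re| ≤ ‖a‖ * ‖b‖ := by
    intro a b
    calc _ ≤ ‖a * conj b‖ := Complex.abs_re_le_norm _
      _ = _ := by rw [norm_mul, RCLike.norm_conj]
  have c1 : -(R.u3 0 * conj (R.u1 0)).re ≤ K3 * K1 * S ^ 2 :=
    (neg_le_abs _).trans ((hre _ _).trans
      ((mul_le_mul b3 b1 (norm_nonneg _) (by positivity)).trans (le_of_eq (by ring))))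
  have c2 : -(R.u2 0 * conj (R.u1 0)).re ≤ K2 * K1 * S ^ 2 :=
    (neg_le_abs _).trans ((hre _ _).trans
      ((mul_le_mul b2 b1 (norm_nonneg _) (by positivity)).trans (le_of_eq (by ring))))
  have c3 : ‖R.u2 0‖ ^ 2 ≤ K2 ^ 2 * S ^ 2 := by rw [← mul_pow]; gcongr
  have c4 : R.lam ^ 2 * ‖R.u 0‖ ^ 2 ≤ K0 ^ 2 * S ^ 2 := by
    rw [← sq_abs R.lam, ← mul_pow, ← mul_pow]; gcongr
  have d1 := mul_le_mul_of_nonneg_left c1 (show 0 ≤ ℓ * (2 * α) by positivity)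
  have d2 := mul_le_mul_of_nonneg_left c2 (show 0 ≤ 2 * α by positivity)
  have d3 := mul_le_mul_of_nonneg_left c3 (show 0 ≤ ℓ * α by positivity)
  have d4 := mul_le_mul_of_nonneg_left c4 hℓ.le
  linarith

lemma main_bd (hℓ : 0 < ℓ) (hα : 0 < α) (hm : 0 < m) (hd : 0 < d) (hJ : 0 < J)
    (hγ : 0 < γ) (hγs : 0 < γs) :
    ∃ C > 0, ∀ R : ResolventSol ℓ α m d J γ γs, 1 ≤ |R.lam| →
      normU R ^ 2 ≤ C * R.lam ^ 2 * ((‖R.v 0‖ ^ 2 + ‖R.v1 0‖ ^ 2) + normF R ^ 2) := by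
  obtain ⟨K, hK, hb⟩ := boundary_bd hℓ hα hm hd hJ hγ hγs
  obtain ⟨B, hB⟩ : ∃ B, B = 2 * ℓ ^ 4 / α + 2 * ℓ ^ 8 / α ^ 2 := ⟨_, rfl⟩
  have pB : 0 < B := by rw [hB]; positivity
  refine ⟨2 * (K + B) + 2 * (ℓ ^ 3 / α) * ℓ + (2 * m + (2 * m * d ^ 2 + J)),
    by positivity, ?_⟩
  intro R hl
  have h1 := (interior_bd hℓ hα hm hJ R hl).trans (hb R hl)
  rw [← hB] at h1
  have hl2 : 1 ≤ R.lam ^ 2 := by rw [← sq_abs]; nlinarith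
  have hcu := cu R
  have hcv := cv R
  have hcu2 := cu2 R
  rw [normU_sq hℓ hα hm hJ R]
  set P := normF R
  obtain ⟨E, hE⟩ : ∃ E, E = ‖R.v 0‖ ^ 2 + ‖R.v1 0‖ ^ 2 := ⟨_, rfl⟩
  rw [← hE] at h1 ⊢
  have hE0 : 0 ≤ E := by rw [hE]; positivity
  have hi3 : IntervalIntegrable (fun x => 2 * R.lam ^ 2 * ‖R.u x‖ ^ 2 + α * ‖R.u2 x‖ ^ 2)
    volume 0 ℓ := aux_int hℓ (by fun_prop)
  have h2 : (∫ x in (0:ℝ)..ℓ, (‖R.v x‖ ^ 2 + α * ‖R.u2 x‖ ^ 2)) ≤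
      ∫ x in (0:ℝ)..ℓ, ((2 * R.lam ^ 2 * ‖R.u x‖ ^ 2 + α * ‖R.u2 x‖ ^ 2)
        + 2 * (ℓ ^ 3 / α * P ^ 2)) := by
    apply intervalIntegral.integral_mono_on hℓ.le (aux_int hℓ (by fun_prop))
      (aux_int hℓ (by fun_prop))
    intro x hx
    have a2 := f1_bound hℓ hα hm hJ R x hx
    have e : R.v x = Complex.I * R.lam * R.u x - R.f1 x := by
      linear_combination -R.res1 x hx
    have a3 : ‖R.v x‖ ≤ |R.lam| * ‖R.u x‖ + ‖R.f1 x‖ := by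
      rw [e]; refine (norm_sub_le _ _).trans (le_of_eq ?_); simp
    have a4 : ‖R.v x‖ ^ 2 ≤ 2 * R.lam ^ 2 * ‖R.u x‖ ^ 2 + 2 * ‖R.f1 x‖ ^ 2 := by
      calc ‖R.v x‖ ^ 2 ≤ (|R.lam| * ‖R.u x‖ + ‖R.f1 x‖) ^ 2 := by gcongr
        _ ≤ 2 * (|R.lam| * ‖R.u x‖) ^ 2 + 2 * ‖R.f1 x‖ ^ 2 := by
          nlinarith [sq_nonneg (|R.lam| * ‖R.u x‖ - ‖R.f1 x‖)]
        _ = _ := by rw [mul_pow, sq_abs]; ring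
    linarith
  rw [intervalIntegral.integral_add hi3 intervalIntegrable_const, integ_add hℓ hcu hcu2,
    intervalIntegral.integral_const] at h2
  simp only [sub_zero, smul_eq_mul] at h2
  have h3 : m * ‖R.v 0 + d * R.v1 0‖ ^ 2 + J * ‖R.v1 0‖ ^ 2 ≤
      (2 * m + (2 * m * d ^ 2 + J)) * E := by
    have a3 : ‖R.v 0 + d * R.v1 0‖ ≤ ‖R.v 0‖ + d * ‖R.v1 0‖ := by
      refine (norm_add_le _ _).trans (le_of_eq ?_)
      simp [abs_of_pos hd]
    have a4 : ‖R.v 0 + d * R.v1 0‖ ^ 2 ≤ 2 * ‖R.v 0‖ ^ 2 + 2 * d ^ 2 * ‖R.v1 0‖ ^ 2 := by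
      calc _ ≤ (‖R.v 0‖ + d * ‖R.v1 0‖) ^ 2 := by gcongr
        _ ≤ _ := by nlinarith [sq_nonneg (‖R.v 0‖ - d * ‖R.v1 0‖)]
    have a5 := mul_le_mul_of_nonneg_left a4 hm.le
    have a6 : 0 ≤ 2 * m * ‖R.v1 0‖ ^ 2 := by positivity
    have a7 : 0 ≤ (2 * m * d ^ 2 + J) * ‖R.v 0‖ ^ 2 := by positivity
    rw [hE]
    linarith
  have hI2 := mul_nonneg hα.le (integ_nn hℓ R.u2)
  have g1 : E ≤ R.lam ^ 2 * E := by nlinarith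
  have g2 : P ^ 2 ≤ R.lam ^ 2 * P ^ 2 := by nlinarith [sq_nonneg P]
  have g3 : 0 ≤ R.lam ^ 2 * E := by positivity
  have g4 : 0 ≤ R.lam ^ 2 * P ^ 2 := by positivity
  have pA : 0 < 2 * (ℓ ^ 3 / α) * ℓ := by positivity
  have pM : 0 < 2 * m + (2 * m * d ^ 2 + J) := by positivity
  have k1 := mul_le_mul_of_nonneg_left g2 hK.le
  have k2 := mul_le_mul_of_nonneg_left g2 pA.le
  have k3 := mul_le_mul_of_nonneg_left g1 pM.le
  have k4 := mul_nonneg pB.le g3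
  have k5 := mul_nonneg pA.le g3
  have k6 := mul_nonneg pM.le g4
  linarith

/-- Resolvent estimate `‖U‖ ≤ c λ² ‖F‖` for large real `λ`, i.e.
`‖(iλ − A)⁻¹‖ = O(λ²)`, which underlies the polynomial decay of the semigroup at the
rate `t^{-1/2}`. -/
theorem resolvent_polynomial_estimate (ℓ α m d J γ γs : ℝ)
    (hℓ : 0 < ℓ) (hα : 0 < α) (hm : 0 < m) (hd : 0 < d) (hJ : 0 < J)
    (hγ : 0 < γ) (hγs : 0 < γs) (hyp : d * γ ≤ 2 * γs) :
    ∃ c > 0, ∃ lam0 ≥ (1:ℝ), ∀ R : ResolventSol ℓ α m d J γ γs, lam0 ≤ |R.lam| →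
      normU R ≤ c * R.lam ^ 2 * normF R := by
  obtain ⟨C, hC, hmain⟩ := main_bd (m := m) (J := J) hℓ hα hm hd hJ hγ hγs
  obtain ⟨κ, hκ⟩ : ∃ κ, κ = γ / 8 * min 1 (d ^ 2) := ⟨_, rfl⟩
  have pκ : 0 < κ := by rw [hκ]; positivity
  refine ⟨√(C ^ 2 / κ ^ 2 + 2 * C), by positivity, 1, le_rfl, ?_⟩
  intro R hl
  have hl2 : 1 ≤ R.lam ^ 2 := by rw [← sq_abs]; nlinarith
  have hl0 : 0 < R.lam ^ 2 := by linarith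
  have h1 := hmain R hl
  have h2 := energy hℓ hα hm hJ R (t := κ / (C * R.lam ^ 2)) (by positivity)
  have hP0 : 0 ≤ normF R := Real.sqrt_nonneg _
  set N := normU R
  set P := normF R
  have h3 : κ * (‖R.v 0‖ ^ 2 + ‖R.v1 0‖ ^ 2) ≤
      γ * ‖R.v 0‖ ^ 2 + d * γ * (R.v 0 * conj (R.v1 0)).re + d * γs * ‖R.v1 0‖ ^ 2 := by
    have a1 : -(‖R.v 0‖ * ‖R.v1 0‖) ≤ (R.v 0 * conj (R.v1 0)).re := by
      have : |(R.v 0 * conj (R.v1 0)).re| ≤ ‖R.v 0‖ * ‖R.v1 0‖ := by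
        calc _ ≤ ‖R.v 0 * conj (R.v1 0)‖ := Complex.abs_re_le_norm _
          _ = _ := by rw [norm_mul, RCLike.norm_conj]
      exact (abs_le.1 this).1
    have a2 := mul_le_mul_of_nonneg_left a1 (mul_pos hd hγ).le
    have a3 := mul_le_mul_of_nonneg_right hyp (show 0 ≤ d / 2 * ‖R.v1 0‖ ^ 2 by positivity)
    have a4 : κ * ‖R.v 0‖ ^ 2 ≤ γ / 8 * 1 * ‖R.v 0‖ ^ 2 := by
      rw [hκ]; gcongr; exact min_le_left _ _
    have a5 : κ * ‖R.v1 0‖ ^ 2 ≤ γ / 8 * d ^ 2 * ‖R.v1 0‖ ^ 2 := by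
      rw [hκ]; gcongr; exact min_le_right _ _
    have a6 : 0 ≤ γ * (7 / 8 * ‖R.v 0‖ ^ 2 - d * ‖R.v 0‖ * ‖R.v1 0‖
        + 3 / 8 * d ^ 2 * ‖R.v1 0‖ ^ 2) := by
      apply mul_nonneg hγ.le
      nlinarith [sq_nonneg (‖R.v 0‖ - 4 / 7 * (d * ‖R.v1 0‖)), sq_nonneg (d * ‖R.v1 0‖)]
    linarith
  set E := ‖R.v 0‖ ^ 2 + ‖R.v1 0‖ ^ 2
  have h4 : C * R.lam ^ 2 * E ≤ N ^ 2 / 2 + C ^ 2 / κ ^ 2 * (R.lam ^ 2) ^ 2 * P ^ 2 / 2 := by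
    have := mul_le_mul_of_nonneg_left (h3.trans h2) (show 0 ≤ C * R.lam ^ 2 / κ by positivity)
    calc C * R.lam ^ 2 * E = C * R.lam ^ 2 / κ * (κ * E) := by field_simp
      _ ≤ _ := this
      _ = _ := by
        generalize R.lam ^ 2 = y at hl0
        field_simp
  have h5 : C * R.lam ^ 2 * P ^ 2 ≤ C * (R.lam ^ 2) ^ 2 * P ^ 2 := by
    have : R.lam ^ 2 ≤ (R.lam ^ 2) ^ 2 := by nlinarith
    exact mul_le_mul_of_nonneg_right (mul_le_mul_of_nonneg_left this hC.le) (sq_nonneg P)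
  have h6 : N ^ 2 ≤ (√(C ^ 2 / κ ^ 2 + 2 * C) * R.lam ^ 2 * P) ^ 2 := by
    rw [mul_pow, mul_pow, Real.sq_sqrt (by positivity)]
    linarith
  exact (abs_le_of_sq_le_sq' h6 (by positivity)).2
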